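/- Suppose p_XY has full support. Then (p_XY, p_{Z|XY}) is computable with perfect security if and only if both of the following hold: (1) for all y, y' ∈ Y, k(y) = k(y') =: k and {α_1^(y), …, α_k^(y)} = {α_1^(y'), …, α_k^(y')} as sets of probability vectors on X; and (2) with the classes indexed so that α_i^(y) = α_i^(y') for all i ∈ [k] and all y, y' ∈ Y (such an indexing is possible and unique by (1)), one has Σ_{z∈Z_i^(y)} p_{Z|XY}(z|x,y) = Σ_{z∈Z_i^(y')} p_{Z|XY}(z|x,y') for every i ∈ [k], every x ∈ X, and all y, y' ∈ Y. -/

import Mathlib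

open scoped BigOperators
open scoped Classical

namespace SC

/-- `p` is a probability mass function on a finite type. -/
def IsPMF {α : Type*} [Fintype α] (p : α → ℝ) : Prop :=
  (∀ a, 0 ≤ p a) ∧ ∑ a, p a = 1

/-- Total variation distance between pmfs on a finite type. -/
noncomputable def tv {α : Type*} [Fintype α] (p q : α → ℝ) : ℝ :=
  (1 / 2) * ∑ a, |p a - q a|

/-- Shannon entropy (in bits) of the pushforward of the pmf `p` along `f`. -/
noncomputable def Hof {Ω β : Type*} [Fintype Ω] (p : Ω → ℝ) (f : Ω → β) : ℝ :=
  (∑ b ∈ Finset.univ.image f,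
      Real.negMulLog (∑ a ∈ Finset.univ.filter (fun a => f a = b), p a)) / Real.log 2

/-- Conditional Shannon entropy `H(A | B)` (bits) computed from the joint pmf `p`. -/
noncomputable def condEnt {Ω α β : Type*} [Fintype Ω] (p : Ω → ℝ)
    (A : Ω → α) (B : Ω → β) : ℝ :=
  Hof p (fun ω => (A ω, B ω)) - Hof p B

/-- Conditional mutual information `I(A ; C ∣ B)` (bits) from the joint pmf `p`. -/
noncomputable def cmi {Ω α β γ : Type*} [Fintype Ω] (p : Ω → ℝ)
    (A : Ω → α) (B : Ω → β) (C : Ω → γ) : ℝ :=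
  Hof p (fun ω => (A ω, B ω)) + Hof p (fun ω => (B ω, C ω)) - Hof p B
    - Hof p (fun ω => (A ω, B ω, C ω))

/-- The joint pmf `p_XYZ(x,y,z) = p_XY(x,y) · p_{Z|XY}(z|x,y)`. -/
noncomputable def jointXYZ {𝒳 𝒴 𝒵 : Type*} [Fintype 𝒳] [Fintype 𝒴] [Fintype 𝒵]
    (pXY : 𝒳 × 𝒴 → ℝ) (Q : 𝒳 → 𝒴 → 𝒵 → ℝ) : 𝒳 × 𝒴 × 𝒵 → ℝ :=
  fun w => pXY (w.1, w.2.1) * Q w.1 w.2.1 w.2.2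

/-- The `n`-fold product of `p_XYZ`. -/
noncomputable def prodXYZ {𝒳 𝒴 𝒵 : Type*} [Fintype 𝒳] [Fintype 𝒴] [Fintype 𝒵]
    (pXY : 𝒳 × 𝒴 → ℝ) (Q : 𝒳 → 𝒴 → 𝒵 → ℝ) (n : ℕ) :
    (Fin n → 𝒳) × (Fin n → 𝒴) × (Fin n → 𝒵) → ℝ :=
  fun w => ∏ i, jointXYZ pXY Q (w.1 i, w.2.1 i, w.2.2 i)

/-- The joint pmf of `(U, X, Y, Z)` obtained from `p_XYZ` and a conditional pmf
`p_{U|XYZ}` (with `U` ranging over `Fin k`). -/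
noncomputable def jointU {𝒳 𝒴 𝒵 : Type*} [Fintype 𝒳] [Fintype 𝒴] [Fintype 𝒵]
    (pXY : 𝒳 × 𝒴 → ℝ) (Q : 𝒳 → 𝒴 → 𝒵 → ℝ) {k : ℕ}
    (pU : 𝒳 × 𝒴 × 𝒵 → Fin k → ℝ) : Fin k × 𝒳 × 𝒴 × 𝒵 → ℝ :=
  fun w => jointXYZ pXY Q w.2 * pU w.2 w.1

/-- `p_{U|XYZ}` is a conditional pmf whose joint pmf `p_XYZ · p_{U|XYZ}` satisfies the
three Markov chains `U−X−Y`, `Z−(U,Y)−X` and `U−(Y,Z)−X`. -/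
def SecureAux {𝒳 𝒴 𝒵 : Type*} [Fintype 𝒳] [Fintype 𝒴] [Fintype 𝒵]
    (pXY : 𝒳 × 𝒴 → ℝ) (Q : 𝒳 → 𝒴 → 𝒵 → ℝ) {k : ℕ}
    (pU : 𝒳 × 𝒴 × 𝒵 → Fin k → ℝ) : Prop :=
  (∀ w, IsPMF (pU w)) ∧
  cmi (jointU pXY Q pU) (fun w => w.1) (fun w => w.2.1) (fun w => w.2.2.1) = 0 ∧
  cmi (jointU pXY Q pU) (fun w => w.2.2.2) (fun w => (w.1, w.2.2.1)) (fun w => w.2.1) = 0 ∧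
  cmi (jointU pXY Q pU) (fun w => w.1) (fun w => (w.2.2.1, w.2.2.2)) (fun w => w.2.1) = 0

/-- `(p_XY, p_{Z|XY})` is computable with perfect security. -/
def PerfectlySecure {𝒳 𝒴 𝒵 : Type*} [Fintype 𝒳] [Fintype 𝒴] [Fintype 𝒵]
    (pXY : 𝒳 × 𝒴 → ℝ) (Q : 𝒳 → 𝒴 → 𝒵 → ℝ) : Prop :=
  ∃ (k : ℕ) (pU : 𝒳 × 𝒴 × 𝒵 → Fin k → ℝ), SecureAux pXY Q pU

/-- `Z^(y)`: outputs occurring with positive probability when Bob's input is `y`. -/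
def Zyset {𝒳 𝒴 𝒵 : Type*} (Q : 𝒳 → 𝒴 → 𝒵 → ℝ) (y : 𝒴) : Set 𝒵 :=
  {z | ∃ x, 0 < Q x y z}

/-- `z ∼_y z'`: the columns of `z` and `z'` are positive scalar multiples of each
other (both in `Z^(y)`). -/
def SimRel {𝒳 𝒴 𝒵 : Type*} (Q : 𝒳 → 𝒴 → 𝒵 → ℝ) (y : 𝒴) (z z' : 𝒵) : Prop :=
  z ∈ Zyset Q y ∧ z' ∈ Zyset Q y ∧ ∃ c : ℝ, 0 < c ∧ ∀ x, Q x y z = c * Q x y z'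

/-- The `≡_y`-equivalence class of `z₀`, where `≡_y` is the equivalence relation
generated by `∼_y`. -/
def classOf {𝒳 𝒴 𝒵 : Type*} (Q : 𝒳 → 𝒴 → 𝒵 → ℝ) (y : 𝒴) (z₀ : 𝒵) : Set 𝒵 :=
  {z | Relation.EqvGen (SimRel Q y) z z₀}

/-- The probability column vector `α` of (the class of) `z`: the normalized column. -/
noncomputable def alphaVec {𝒳 𝒴 𝒵 : Type*} [Fintype 𝒳]
    (Q : 𝒳 → 𝒴 → 𝒵 → ℝ) (y : 𝒴) (z : 𝒵) : 𝒳 → ℝ :=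
  fun x => Q x y z / ∑ x', Q x' y z

/-- The set `{α_1^(y), …, α_{k(y)}^(y)}` of probability vectors of the classes at `y`. -/
def alphaSet {𝒳 𝒴 𝒵 : Type*} [Fintype 𝒳] (Q : 𝒳 → 𝒴 → 𝒵 → ℝ) (y : 𝒴) :
    Set (𝒳 → ℝ) :=
  alphaVec Q y '' Zyset Q y

/-- `Σ_{z ∈ Z_i^(y)} p_{Z|XY}(z|x,y)` where `Z_i^(y)` is the class of `z₀`. -/
noncomputable def classSumOf {𝒳 𝒴 𝒵 : Type*} [Fintype 𝒵]
    (Q : 𝒳 → 𝒴 → 𝒵 → ℝ) (x : 𝒳) (y : 𝒴) (z₀ : 𝒵) : ℝ :=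
  ∑ z ∈ Finset.univ.filter (fun z => z ∈ classOf Q y z₀), Q x y z

/-- `Σ_{z ∈ Z_i^(y)} p_{Z|XY}(z|x,y)` where `Z_i^(y)` is the class with vector `α`. -/
noncomputable def classSumA {𝒳 𝒴 𝒵 : Type*} [Fintype 𝒳] [Fintype 𝒵]
    (Q : 𝒳 → 𝒴 → 𝒵 → ℝ) (x : 𝒳) (y : 𝒴) (α : 𝒳 → ℝ) : ℝ :=
  ∑ z ∈ Finset.univ.filter (fun z => z ∈ Zyset Q y ∧ alphaVec Q y z = α), Q x y z

section CondMutualInfo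

variable {Ω α β γ : Type*} [Fintype Ω]

/-- The pushforward of the weight `p` along `f`. -/
noncomputable def marginal (p : Ω → ℝ) (f : Ω → β) (b : β) : ℝ :=
  ∑ ω, if f ω = b then p ω else 0

lemma marginal_nonneg {p : Ω → ℝ} (hp : ∀ ω, 0 ≤ p ω) (f : Ω → β) (b : β) :
    0 ≤ marginal p f b :=
  Finset.sum_nonneg fun ω _ => by split_ifs <;> simp [hp]

/-- Shrinking an event shrinks its weight. -/
lemma marginal_le_marginal {p : Ω → ℝ} (hp : ∀ ω, 0 ≤ p ω) {f : Ω → α} {g : Ω → β} {a : α}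
    {b : β} (h : ∀ ω, f ω = a → g ω = b) : marginal p f a ≤ marginal p g b := by
  refine Finset.sum_le_sum fun ω _ => ?_
  by_cases hf : f ω = a
  · rw [if_pos hf, if_pos (h ω hf)]
  · rw [if_neg hf]
    split_ifs <;> simp [hp]

lemma marginal_apply_of_injective (p : Ω → ℝ) {f : Ω → β} (hf : Function.Injective f) (ω : Ω) :
    marginal p f (f ω) = p ω := by
  simp [marginal, hf.eq_iff]

lemma Hof_eq_sum_marginal [Fintype β] (p : Ω → ℝ) (f : Ω → β) :
    Hof p f = (∑ b, Real.negMulLog (marginal p f b)) / Real.log 2 := by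
  unfold Hof
  congr 1
  rw [← Finset.sum_subset (Finset.subset_univ (Finset.univ.image f))]
  · exact Finset.sum_congr rfl fun b _ => by rw [marginal, Finset.sum_filter]
  · intro b _ hb
    have h : ∀ ω, f ω ≠ b := by simpa using hb
    simp [marginal, h]

lemma sum_marginal_prodMk [Fintype β] (p : Ω → ℝ) (f : Ω → α) (g : Ω → β) (a : α) :
    ∑ b, marginal p (fun ω => (f ω, g ω)) (a, b) = marginal p f a := by
  unfold marginal
  rw [Finset.sum_comm]
  refine Finset.sum_congr rfl fun ω _ => ?_
  by_cases h : f ω = a <;> simp [h]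

lemma sum_marginal_prodMk_left [Fintype α] (p : Ω → ℝ) (f : Ω → α) (g : Ω → β) (b : β) :
    ∑ a, marginal p (fun ω => (f ω, g ω)) (a, b) = marginal p g b := by
  unfold marginal
  rw [Finset.sum_comm]
  refine Finset.sum_congr rfl fun ω _ => ?_
  by_cases h : g ω = b <;> simp [h]

lemma sum_marginal_prodMk_middle [Fintype γ] (p : Ω → ℝ) (f : Ω → α) (g : Ω → β) (h : Ω → γ)
    (a : α) (b : β) :
    ∑ c, marginal p (fun ω => (f ω, g ω, h ω)) (a, b, c) =
      marginal p (fun ω => (f ω, g ω)) (a, b) := by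
  unfold marginal
  rw [Finset.sum_comm]
  refine Finset.sum_congr rfl fun ω _ => ?_
  by_cases h : f ω = a <;> by_cases h' : g ω = b <;> simp [h, h']

/-- The integrand of a relative entropy, normalised to be nonnegative. -/
lemma mul_klFun_div {x s : ℝ} (hs : s ≠ 0) :
    s * InformationTheory.klFun (x / s) = x * Real.log (x / s) - (x - s) := by
  unfold InformationTheory.klFun
  field_simp
  ring

lemma sum_mul_klFun_div_eq_zero_iff {ι : Type*} [Fintype ι] {x s : ι → ℝ}
    (hx : ∀ i, 0 ≤ x i) (hs : ∀ i, 0 ≤ s i) (hxs : ∀ i, s i = 0 → x i = 0) :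
    ∑ i, s i * InformationTheory.klFun (x i / s i) = 0 ↔ ∀ i, x i = s i := by
  have hdiv : ∀ i, 0 ≤ x i / s i := fun i => div_nonneg (hx i) (hs i)
  rw [Finset.sum_eq_zero_iff_of_nonneg fun i _ =>
    mul_nonneg (hs i) (InformationTheory.klFun_nonneg (hdiv i))]
  simp only [Finset.mem_univ, true_imp_iff]
  refine forall_congr' fun i => ?_
  by_cases h : s i = 0
  · simp [h, hxs i h]
  · rw [mul_eq_zero, or_iff_right h, InformationTheory.klFun_eq_zero_iff (hdiv i),
      div_eq_one_iff_eq h]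

/-- The combination of entropies defining conditional mutual information is the relative
entropy to the conditionally independent coupling. -/
lemma entropy_combination_eq_sum_klFun [Fintype α] [Fintype β] [Fintype γ] (q : α → β → γ → ℝ) (hq : ∀ a b c, 0 ≤ q a b c)
    (mab : α → β → ℝ) (mbc : β → γ → ℝ) (mb : β → ℝ)
    (hab : ∀ a b, ∑ c, q a b c = mab a b) (hbc : ∀ b c, ∑ a, q a b c = mbc b c)
    (ha : ∀ b, ∑ a, mab a b = mb b) (hc : ∀ b, ∑ c, mbc b c = mb b) :
    (∑ a, ∑ b, Real.negMulLog (mab a b)) + (∑ b, ∑ c, Real.negMulLog (mbc b c))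
      - (∑ b, Real.negMulLog (mb b)) - (∑ a, ∑ b, ∑ c, Real.negMulLog (q a b c)) =
    ∑ a, ∑ b, ∑ c, mab a b * mbc b c / mb b *
      InformationTheory.klFun (q a b c / (mab a b * mbc b c / mb b)) := by
  have hab0 : ∀ a b, 0 ≤ mab a b := fun a b => hab a b ▸ Finset.sum_nonneg fun c _ => hq a b c
  have hbc0 : ∀ b c, 0 ≤ mbc b c := fun b c => hbc b c ▸ Finset.sum_nonneg fun a _ => hq a b c
  have term : ∀ a b c, mab a b * mbc b c / mb b *
      InformationTheory.klFun (q a b c / (mab a b * mbc b c / mb b)) =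
      q a b c * Real.log (q a b c) + q a b c * Real.log (mb b)
      - q a b c * Real.log (mab a b) - q a b c * Real.log (mbc b c)
      - (q a b c - mab a b * mbc b c / mb b) := by
    intro a b c
    have hqab : q a b c ≤ mab a b :=
      hab a b ▸ Finset.single_le_sum (f := fun c => q a b c) (fun c _ => hq a b c) (Finset.mem_univ c)
    have hqbc : q a b c ≤ mbc b c :=
      hbc b c ▸ Finset.single_le_sum (f := fun a => q a b c) (fun a _ => hq a b c) (Finset.mem_univ a)
    have habb : mab a b ≤ mb b :=
      ha b ▸ Finset.single_le_sum (f := fun a => mab a b) (fun a _ => hab0 a b) (Finset.mem_univ a)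
    by_cases hs : mab a b * mbc b c / mb b = 0
    · have : q a b c = 0 := by
        apply le_antisymm _ (hq a b c)
        rcases div_eq_zero_iff.1 hs with h | h
        · rcases mul_eq_zero.1 h with h | h <;> linarith
        · linarith
      simp [hs, this]
    · rw [mul_klFun_div hs]
      rcases (hq a b c).eq_or_lt with h | h
      · simp [← h]
      · have h1 : mab a b ≠ 0 := by linarith
        have h2 : mbc b c ≠ 0 := by linarith
        have h3 : mb b ≠ 0 := by linarith
        rw [Real.log_div h.ne' hs, Real.log_div (mul_ne_zero h1 h2) h3, Real.log_mul h1 h2]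
        ring
  have e1 : ∑ a, ∑ b, ∑ c, q a b c * Real.log (mb b) = -∑ b, Real.negMulLog (mb b) := by
    rw [Finset.sum_comm, ← Finset.sum_neg_distrib]
    refine Finset.sum_congr rfl fun b _ => ?_
    simp_rw [← Finset.sum_mul, hab, ha, Real.negMulLog]
    ring
  have e2 : ∑ a, ∑ b, ∑ c, q a b c * Real.log (mab a b) =
      -∑ a, ∑ b, Real.negMulLog (mab a b) := by
    simp_rw [← Finset.sum_mul, hab, Real.negMulLog, neg_mul, Finset.sum_neg_distrib, neg_neg]
  have e3 : ∑ a, ∑ b, ∑ c, q a b c * Real.log (mbc b c) =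
      -∑ b, ∑ c, Real.negMulLog (mbc b c) := by
    rw [Finset.sum_comm, ← Finset.sum_neg_distrib]
    refine Finset.sum_congr rfl fun b _ => ?_
    rw [Finset.sum_comm]
    simp_rw [← Finset.sum_mul, hbc, Real.negMulLog, neg_mul, Finset.sum_neg_distrib, neg_neg]
  have e4 : ∑ a, ∑ b, ∑ c, (q a b c - mab a b * mbc b c / mb b) = 0 := by
    rw [Finset.sum_comm]
    refine Finset.sum_eq_zero fun b _ => ?_
    simp_rw [Finset.sum_sub_distrib, ← Finset.sum_div, ← Finset.mul_sum, hab, hc,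
      ← Finset.sum_mul, ha]
    by_cases h : mb b = 0 <;> simp [h]
  have e5 : ∑ a, ∑ b, ∑ c, q a b c * Real.log (q a b c) =
      -∑ a, ∑ b, ∑ c, Real.negMulLog (q a b c) := by
    simp_rw [Real.negMulLog, neg_mul, Finset.sum_neg_distrib, neg_neg]
  simp_rw [term]
  simp only [Finset.sum_sub_distrib, Finset.sum_add_distrib] at *
  linarith

/-- Conditional mutual information vanishes iff the joint marginal is the conditionally
independent coupling of its two-variable marginals. -/
theorem cmi_eq_zero_iff [Fintype α] [Fintype β] [Fintype γ] {p : Ω → ℝ} (hp : ∀ ω, 0 ≤ p ω)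
    (A : Ω → α) (B : Ω → β) (C : Ω → γ) :
    cmi p A B C = 0 ↔ ∀ a b c, marginal p (fun ω => (A ω, B ω, C ω)) (a, b, c) =
      marginal p (fun ω => (A ω, B ω)) (a, b) * marginal p (fun ω => (B ω, C ω)) (b, c) /
        marginal p B b := by
  have key := entropy_combination_eq_sum_klFun
    (fun a b c => marginal p (fun ω => (A ω, B ω, C ω)) (a, b, c))
    (fun _ _ _ => marginal_nonneg hp _ _)
    (fun a b => marginal p (fun ω => (A ω, B ω)) (a, b))
    (fun b c => marginal p (fun ω => (B ω, C ω)) (b, c)) (marginal p B)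
    (fun a b => sum_marginal_prodMk_middle p A B C a b)
    (fun b c => sum_marginal_prodMk_left p A (fun ω => (B ω, C ω)) (b, c))
    (fun b => sum_marginal_prodMk_left p A B b) (fun b => sum_marginal_prodMk p B C b)
  have hlog : Real.log 2 ≠ 0 := (Real.log_pos one_lt_two).ne'
  have hcmi : cmi p A B C = 0 ↔ cmi p A B C * Real.log 2 = 0 := by simp [hlog]
  have hmul : cmi p A B C * Real.log 2 = _ := Eq.trans (by
    simp only [cmi, Hof_eq_sum_marginal, Fintype.sum_prod_type]
    field_simp) key
  have hiff := sum_mul_klFun_div_eq_zero_iff (ι := α × β × γ)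
    (x := fun i => marginal p (fun ω => (A ω, B ω, C ω)) i)
    (s := fun i => marginal p (fun ω => (A ω, B ω)) (i.1, i.2.1) *
      marginal p (fun ω => (B ω, C ω)) i.2 / marginal p B i.2.1)
    (fun i => marginal_nonneg hp _ _)
    (fun i => div_nonneg (mul_nonneg (marginal_nonneg hp _ _) (marginal_nonneg hp _ _))
      (marginal_nonneg hp _ _))
    (fun i hi => by
      have zero_of_le {t : ℝ} (ht : marginal p (fun ω => (A ω, B ω, C ω)) i ≤ t)
          (h0 : t = 0) : marginal p (fun ω => (A ω, B ω, C ω)) i = 0 :=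
        le_antisymm (h0 ▸ ht) (marginal_nonneg hp _ _)
      rcases div_eq_zero_iff.1 hi with h | h
      · rcases mul_eq_zero.1 h with h | h
        · exact zero_of_le (marginal_le_marginal hp fun ω hω => by simp [← hω]) h
        · exact zero_of_le (marginal_le_marginal hp fun ω hω => by simp [← hω]) h
      · exact zero_of_le (marginal_le_marginal hp fun ω hω => by simp [← hω]) h)
  simp only [Fintype.sum_prod_type, Prod.forall] at hiff
  rw [hcmi, hmul, hiff]

/-- A product factorization of the joint marginal forces conditional independence. -/
theorem cmi_eq_zero_of_factorization [Fintype α] [Fintype β] [Fintype γ] {p : Ω → ℝ}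
    (hp : ∀ ω, 0 ≤ p ω) {A : Ω → α} {B : Ω → β} {C : Ω → γ} (F : α → β → ℝ) (G : β → γ → ℝ)
    (h : ∀ a b c, marginal p (fun ω => (A ω, B ω, C ω)) (a, b, c) = F a b * G b c) :
    cmi p A B C = 0 := by
  rw [cmi_eq_zero_iff hp]
  intro a b c
  have hab : ∀ a, marginal p (fun ω => (A ω, B ω)) (a, b) = F a b * ∑ c, G b c := fun a => by
    rw [← sum_marginal_prodMk_middle p A B C, Finset.mul_sum]
    exact Finset.sum_congr rfl fun c _ => h a b c
  have hbc : marginal p (fun ω => (B ω, C ω)) (b, c) = (∑ a, F a b) * G b c := by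
    rw [← sum_marginal_prodMk_left p A (fun ω => (B ω, C ω)), Finset.sum_mul]
    exact Finset.sum_congr rfl fun a _ => h a b c
  have hb : marginal p B b = (∑ a, F a b) * ∑ c, G b c := by
    rw [← sum_marginal_prodMk_left p A B, Finset.sum_mul]
    exact Finset.sum_congr rfl fun a _ => hab a
  have hle : marginal p (fun ω => (A ω, B ω, C ω)) (a, b, c) ≤ marginal p B b :=
    marginal_le_marginal hp fun ω hω => by simp_all
  by_cases h0 : marginal p B b = 0
  · rw [h0, div_zero]
    exact le_antisymm (h0 ▸ hle) (marginal_nonneg hp _ _)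
  · rw [eq_div_iff h0, h, hb, hab, hbc]
    ring

end CondMutualInfo

section SecureComputation

variable {𝒳 𝒴 𝒵 : Type*}

lemma alphaVec_eq_of_smul [Fintype 𝒳] {Q : 𝒳 → 𝒴 → 𝒵 → ℝ} {y : 𝒴} {z : 𝒵} {c : ℝ}
    {v : 𝒳 → ℝ} (hc : c ≠ 0) (h : ∀ x, Q x y z = c * v x) :
    alphaVec Q y z = fun x => v x / ∑ x', v x' := by
  funext x
  simp only [alphaVec, h, ← Finset.mul_sum]
  exact mul_div_mul_left _ _ hc

lemma column_sum_pos [Fintype 𝒳] {Q : 𝒳 → 𝒴 → 𝒵 → ℝ} (hQ : ∀ x y z, 0 ≤ Q x y z) {y : 𝒴}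
    {z : 𝒵} (hz : z ∈ Zyset Q y) : 0 < ∑ x, Q x y z := by
  obtain ⟨x, hx⟩ := hz
  exact Finset.sum_pos' (fun x _ => hQ x y z) ⟨x, Finset.mem_univ x, hx⟩

lemma alphaVec_mul_column_sum [Fintype 𝒳] {Q : 𝒳 → 𝒴 → 𝒵 → ℝ} (hQ : ∀ x y z, 0 ≤ Q x y z)
    (x : 𝒳) (y : 𝒴) (z : 𝒵) : alphaVec Q y z x * ∑ x', Q x' y z = Q x y z := by
  refine div_mul_cancel_of_imp fun h => ?_
  exact (Finset.sum_eq_zero_iff_of_nonneg fun x _ => hQ x y z).1 h x (Finset.mem_univ x)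

lemma mem_classOf_iff [Fintype 𝒳] {Q : 𝒳 → 𝒴 → 𝒵 → ℝ} (hQ : ∀ x y z, 0 ≤ Q x y z) {y : 𝒴}
    {z z₀ : 𝒵} (hz₀ : z₀ ∈ Zyset Q y) :
    z ∈ classOf Q y z₀ ↔ z ∈ Zyset Q y ∧ alphaVec Q y z = alphaVec Q y z₀ := by
  constructor
  · intro h
    have key : (z ∈ Zyset Q y ↔ z₀ ∈ Zyset Q y) ∧ alphaVec Q y z = alphaVec Q y z₀ := by
      clear hz₀
      induction h with
      | rel a b hab =>
        obtain ⟨ha, hb, c, hc, hcab⟩ := hab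
        exact ⟨iff_of_true ha hb, alphaVec_eq_of_smul hc.ne' hcab⟩
      | refl a => exact ⟨Iff.rfl, rfl⟩
      | symm a b _ ih => exact ⟨ih.1.symm, ih.2.symm⟩
      | trans a b c _ _ ih ih' => exact ⟨ih.1.trans ih'.1, ih.2.trans ih'.2⟩
    exact ⟨key.1.2 hz₀, key.2⟩
  · rintro ⟨hz, h⟩
    have hs := column_sum_pos hQ hz
    have hs₀ := column_sum_pos hQ hz₀
    refine Relation.EqvGen.rel _ _ ⟨hz, hz₀, _, div_pos hs hs₀, fun x => ?_⟩
    rw [← alphaVec_mul_column_sum hQ x y z, ← alphaVec_mul_column_sum hQ x y z₀, h]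
    field_simp

variable [Fintype 𝒳] [Fintype 𝒵]

lemma classSumOf_eq_classSumA {Q : 𝒳 → 𝒴 → 𝒵 → ℝ} (hQ : ∀ x y z, 0 ≤ Q x y z) {y : 𝒴}
    {z₀ : 𝒵} (hz₀ : z₀ ∈ Zyset Q y) (x : 𝒳) :
    classSumOf Q x y z₀ = classSumA Q x y (alphaVec Q y z₀) := by
  simp only [classSumOf, classSumA, mem_classOf_iff hQ hz₀]

lemma classSumA_eq_sum_ite {Q : 𝒳 → 𝒴 → 𝒵 → ℝ} (hQ : ∀ x y z, 0 ≤ Q x y z) (x : 𝒳) (y : 𝒴)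
    (α : 𝒳 → ℝ) : classSumA Q x y α = ∑ z, if alphaVec Q y z = α then Q x y z else 0 := by
  rw [classSumA, Finset.sum_filter]
  refine Finset.sum_congr rfl fun z _ => ?_
  by_cases hz : z ∈ Zyset Q y
  · simp [hz]
  · have : Q x y z = 0 := le_antisymm (not_lt.1 fun h => hz ⟨x, h⟩) (hQ x y z)
    simp [this]

lemma classSumA_nonneg {Q : 𝒳 → 𝒴 → 𝒵 → ℝ} (hQ : ∀ x y z, 0 ≤ Q x y z) (x : 𝒳) (y : 𝒴)
    (α : 𝒳 → ℝ) : 0 ≤ classSumA Q x y α :=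
  Finset.sum_nonneg fun z _ => hQ x y z

lemma mem_alphaSet_iff {Q : 𝒳 → 𝒴 → 𝒵 → ℝ} (hQ : ∀ x y z, 0 ≤ Q x y z) {y : 𝒴} {α : 𝒳 → ℝ} :
    α ∈ alphaSet Q y ↔ ∃ x, 0 < classSumA Q x y α := by
  constructor
  · rintro ⟨z, ⟨x, hx⟩, rfl⟩
    exact ⟨x, Finset.sum_pos' (fun z _ => hQ x y z) ⟨z, by simpa using ⟨x, hx⟩, hx⟩⟩
  · rintro ⟨x, hx⟩
    obtain ⟨z, hz, -⟩ := Finset.exists_ne_zero_of_sum_ne_zero hx.ne'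
    exact ⟨z, by simpa using hz⟩

/-- Both matching conditions together say that the class sums, indexed by probability
vectors, do not depend on `y`. -/
lemma class_conditions_iff_classSumA_eq {Q : 𝒳 → 𝒴 → 𝒵 → ℝ} (hQ : ∀ x y z, 0 ≤ Q x y z) :
    ((∀ y y' : 𝒴, (alphaSet Q y).ncard = (alphaSet Q y').ncard ∧
        alphaSet Q y = alphaSet Q y') ∧
      (∀ (y y' : 𝒴) (z₀ z₀' : 𝒵), z₀ ∈ Zyset Q y → z₀' ∈ Zyset Q y' →
        alphaVec Q y z₀ = alphaVec Q y' z₀' →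
        ∀ x, classSumOf Q x y z₀ = classSumOf Q x y' z₀')) ↔
      ∀ y y' x α, classSumA Q x y α = classSumA Q x y' α := by
  constructor
  · rintro ⟨h1, h2⟩ y y' x α
    by_cases hα : α ∈ alphaSet Q y
    · have hα' := hα
      rw [(h1 y y').2] at hα'
      obtain ⟨z, hz, rfl⟩ := hα
      obtain ⟨z', hz', hzz'⟩ := hα'
      rw [← classSumOf_eq_classSumA hQ hz, h2 y y' z z' hz hz' hzz'.symm,
        classSumOf_eq_classSumA hQ hz', hzz']
    · have zero : ∀ y₁, α ∉ alphaSet Q y₁ → classSumA Q x y₁ α = 0 := fun y₁ h =>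
        le_antisymm (not_lt.1 fun hx => h ((mem_alphaSet_iff hQ).2 ⟨x, hx⟩))
          (classSumA_nonneg hQ x y₁ α)
      rw [zero y hα, zero y' ((h1 y y').2 ▸ hα)]
  · intro h
    have hset : ∀ y y', alphaSet Q y = alphaSet Q y' := fun y y' => by
      ext α
      simp only [mem_alphaSet_iff hQ, h y y']
    refine ⟨fun y y' => ⟨by rw [hset y y'], hset y y'⟩, fun y y' z z' hz hz' hzz' x => ?_⟩
    rw [classSumOf_eq_classSumA hQ hz, classSumOf_eq_classSumA hQ hz', hzz', h y y']

variable [Fintype 𝒴]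

/-- For fully supported inputs, the three Markov chains say that the conditional law of
`(U, Z)` given `(X, Y)` has a `U`-marginal `W` depending on `x` only and factors both
through `W` and through `Q`. -/
theorem secureAux_iff_factorization {pXY : 𝒳 × 𝒴 → ℝ} {Q : 𝒳 → 𝒴 → 𝒵 → ℝ}
    (hQ : ∀ x y, IsPMF (Q x y)) (hfs : ∀ x y, 0 < pXY (x, y)) {k : ℕ}
    {pU : 𝒳 × 𝒴 × 𝒵 → Fin k → ℝ} :
    SecureAux pXY Q pU ↔ (∀ w, IsPMF (pU w)) ∧
      ∃ (W : Fin k → 𝒳 → ℝ) (V R : Fin k → 𝒴 → 𝒵 → ℝ),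
        (∀ u x y, ∑ z, Q x y z * pU (x, y, z) u = W u x) ∧
        (∀ u x y z, Q x y z * pU (x, y, z) u = V u y z * W u x) ∧
        (∀ u x y z, Q x y z * pU (x, y, z) u = R u y z * Q x y z) := by
  refine and_congr_right fun hpU => ?_
  have hJ : ∀ w, 0 ≤ jointU pXY Q pU w := fun w =>
    mul_nonneg (mul_nonneg (hfs _ _).le ((hQ _ _).1 _)) ((hpU _).1 _)
  set J := jointU pXY Q pU
  have hJ_apply : ∀ u x y z, J (u, x, y, z) = pXY (x, y) * (Q x y z * pU (x, y, z) u) :=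
    fun u x y z => mul_assoc _ _ _
  have marg_uxy : ∀ u x y, marginal J (fun w => (w.1, w.2.1, w.2.2.1)) (u, x, y) =
      pXY (x, y) * ∑ z, Q x y z * pU (x, y, z) u := by
    intro u x y
    rw [Finset.mul_sum, marginal]
    simp only [Fintype.sum_prod_type, Prod.mk.injEq, ← hJ_apply, ite_and]
    simp only [Finset.sum_ite_eq', Finset.sum_const_zero, Finset.mem_univ, if_true,
      Finset.sum_ite_irrel]
    rw [Finset.sum_comm]
    simp
  have marg_zuyx : ∀ z u y x,
      marginal J (fun w => (w.2.2.2, (w.1, w.2.2.1), w.2.1)) (z, (u, y), x) =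
      J (u, x, y, z) := fun z u y x =>
    marginal_apply_of_injective J (f := fun w => (w.2.2.2, (w.1, w.2.2.1), w.2.1))
      (fun v w h => by simp_all [Prod.ext_iff]) (u, x, y, z)
  have marg_uyzx : ∀ u y z x,
      marginal J (fun w => (w.1, (w.2.2.1, w.2.2.2), w.2.1)) (u, (y, z), x) =
      J (u, x, y, z) := fun u y z x =>
    marginal_apply_of_injective J (f := fun w => (w.1, (w.2.2.1, w.2.2.2), w.2.1))
      (fun v w h => by simp_all [Prod.ext_iff]) (u, x, y, z)
  constructor
  · rintro ⟨h1, h2, h3⟩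
    rw [cmi_eq_zero_iff hJ] at h1 h2 h3
    have marg_xy : ∀ x y, marginal J (fun w => (w.2.1, w.2.2.1)) (x, y) = pXY (x, y) := by
      intro x y
      rw [← sum_marginal_prodMk_left J (fun w => w.1) (fun w => (w.2.1, w.2.2.1))]
      simp_rw [marg_uxy, ← Finset.mul_sum]
      rw [Finset.sum_comm]
      simp_rw [← Finset.mul_sum, (hpU _).2, mul_one, (hQ x y).2, mul_one]
    have marg_uyx : ∀ u y x, marginal J (fun w => ((w.1, w.2.2.1), w.2.1)) ((u, y), x) =
        pXY (x, y) * ∑ z, Q x y z * pU (x, y, z) u := by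
      intro u y x
      rw [← sum_marginal_prodMk_left J (fun w => w.2.2.2) (fun w => ((w.1, w.2.2.1), w.2.1))]
      simp_rw [marg_zuyx, hJ_apply, ← Finset.mul_sum]
    have marg_yzx : ∀ y z x, marginal J (fun w => ((w.2.2.1, w.2.2.2), w.2.1)) ((y, z), x) =
        pXY (x, y) * Q x y z := by
      intro y z x
      rw [← sum_marginal_prodMk_left J (fun w => w.1) (fun w => ((w.2.2.1, w.2.2.2), w.2.1))]
      simp_rw [marg_uyzx, hJ_apply, ← Finset.mul_sum, (hpU _).2, mul_one]
    have hW : ∀ u x y, ∑ z, Q x y z * pU (x, y, z) u =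
        marginal J (fun w => (w.1, w.2.1)) (u, x) / marginal J (fun w => w.2.1) x := by
      intro u x y
      refine mul_left_cancel₀ (hfs x y).ne' ?_
      rw [← marg_uxy, h1, marg_xy]
      ring
    refine ⟨fun u x => marginal J (fun w => (w.1, w.2.1)) (u, x) / marginal J (fun w => w.2.1) x,
      fun u y z => marginal J (fun w => (w.2.2.2, (w.1, w.2.2.1))) (z, (u, y)) /
        marginal J (fun w => (w.1, w.2.2.1)) (u, y),
      fun u y z => marginal J (fun w => (w.1, (w.2.2.1, w.2.2.2))) (u, (y, z)) /
        marginal J (fun w => (w.2.2.1, w.2.2.2)) (y, z),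
      hW, fun u x y z => ?_, fun u x y z => ?_⟩
    · refine mul_left_cancel₀ (hfs x y).ne' ?_
      rw [← hJ_apply, ← marg_zuyx, h2, marg_uyx, hW]
      ring
    · refine mul_left_cancel₀ (hfs x y).ne' ?_
      rw [← hJ_apply, ← marg_uyzx, h3, marg_yzx]
      ring
  · rintro ⟨W, V, R, hW, hV, hR⟩
    refine ⟨cmi_eq_zero_of_factorization hJ W (fun x y => pXY (x, y)) fun u x y => ?_,
      cmi_eq_zero_of_factorization hJ (fun z b => V b.1 b.2 z)
        (fun b x => pXY (x, b.2) * W b.1 x) fun z b x => ?_,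
      cmi_eq_zero_of_factorization hJ (fun u b => R u b.1 b.2)
        (fun b x => pXY (x, b.1) * Q x b.1 b.2) fun u b x => ?_⟩
    · rw [marg_uxy, hW]
      ring
    · rw [marg_zuyx z b.1 b.2 x, hJ_apply, hV]
      ring
    · rw [marg_uyzx u b.1 b.2 x, hJ_apply, hR]
      ring

/-- The class sums of a perfectly secure problem are determined by the law of `U` given
`X`, hence do not depend on `y`. -/
theorem PerfectlySecure.classSumA_eq {pXY : 𝒳 × 𝒴 → ℝ} {Q : 𝒳 → 𝒴 → 𝒵 → ℝ}
    (hQ : ∀ x y, IsPMF (Q x y)) (hfs : ∀ x y, 0 < pXY (x, y)) (h : PerfectlySecure pXY Q)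
    (y y' : 𝒴) (x : 𝒳) (α : 𝒳 → ℝ) : classSumA Q x y α = classSumA Q x y' α := by
  obtain ⟨k, pU, h⟩ := h
  obtain ⟨hpU, W, V, R, hW, hV, hR⟩ := (secureAux_iff_factorization hQ hfs).1 h
  have hQ0 : ∀ x y z, 0 ≤ Q x y z := fun x y => (hQ x y).1
  suffices key : ∀ y, classSumA Q x y α =
      ∑ u, if (fun x => W u x / ∑ x', W u x') = α then W u x else 0 by
    rw [key, key]
  intro y
  have hQsum : ∀ z, Q x y z = ∑ u, Q x y z * pU (x, y, z) u := fun z => by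
    rw [← Finset.mul_sum, (hpU _).2, mul_one]
  have alphaVec_eq : ∀ u z, Q x y z * pU (x, y, z) u ≠ 0 →
      alphaVec Q y z = fun x => W u x / ∑ x', W u x' := by
    intro u z hT
    have hV1 : V u y z ≠ 0 := left_ne_zero_of_mul (hV u x y z ▸ hT)
    have hR1 : R u y z ≠ 0 := left_ne_zero_of_mul (hR u x y z ▸ hT)
    refine alphaVec_eq_of_smul (div_ne_zero hV1 hR1) fun x' => ?_
    rw [div_mul_eq_mul_div, eq_div_iff hR1, ← hV u x' y z, hR u x' y z, mul_comm]
  calc classSumA Q x y α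
      = ∑ z, ∑ u, if alphaVec Q y z = α then Q x y z * pU (x, y, z) u else 0 := by
        rw [classSumA_eq_sum_ite hQ0]
        refine Finset.sum_congr rfl fun z _ => ?_
        split_ifs
        · exact hQsum z
        · simp
    _ = ∑ z, ∑ u, if (fun x => W u x / ∑ x', W u x') = α then
          Q x y z * pU (x, y, z) u else 0 := by
        refine Finset.sum_congr rfl fun z _ => Finset.sum_congr rfl fun u _ => ?_
        by_cases hT : Q x y z * pU (x, y, z) u = 0
        · simp only [hT, ite_self]
        · rw [alphaVec_eq u z hT]
    _ = _ := by
        rw [Finset.sum_comm]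
        refine Finset.sum_congr rfl fun u _ => ?_
        split_ifs
        · exact hW u x y
        · simp

/-- If the class sums do not depend on `y`, revealing the class of `Z` is perfectly
secure. -/
theorem perfectlySecure_of_classSumA_eq [Nonempty 𝒴] {pXY : 𝒳 × 𝒴 → ℝ}
    {Q : 𝒳 → 𝒴 → 𝒵 → ℝ} (hQ : ∀ x y, IsPMF (Q x y)) (hfs : ∀ x y, 0 < pXY (x, y))
    (h : ∀ y y' x α, classSumA Q x y α = classSumA Q x y' α) : PerfectlySecure pXY Q := by
  have hQ0 : ∀ x y z, 0 ≤ Q x y z := fun x y => (hQ x y).1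
  let y₀ : 𝒴 := Classical.arbitrary 𝒴
  let S : Finset (𝒳 → ℝ) := Finset.univ.image fun w : 𝒴 × 𝒵 => alphaVec Q w.1 w.2
  have hS : ∀ y z, alphaVec Q y z ∈ S := fun y z =>
    Finset.mem_image_of_mem (fun w : 𝒴 × 𝒵 => alphaVec Q w.1 w.2) (Finset.mem_univ (y, z))
  let e := S.equivFin
  let a : Fin S.card → 𝒳 → ℝ := fun u => e.symm u
  have ha : ∀ y z u, e ⟨alphaVec Q y z, hS y z⟩ = u ↔ alphaVec Q y z = a u := fun y z u => by
    rw [← e.eq_symm_apply, Subtype.ext_iff]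
  let pU : 𝒳 × 𝒴 × 𝒵 → Fin S.card → ℝ := fun w u =>
    if alphaVec Q w.2.1 w.2.2 = a u then 1 else 0
  let W : Fin S.card → 𝒳 → ℝ := fun u x => classSumA Q x y₀ (a u)
  have hW : ∀ u x y, ∑ z, Q x y z * pU (x, y, z) u = W u x := fun u x y => by
    simp only [W, pU, h y₀ y, classSumA_eq_sum_ite hQ0, mul_ite, mul_one, mul_zero]
  have hpU0 : ∀ w u, 0 ≤ pU w u := fun w u => by
    simp only [pU]
    split_ifs <;> simp
  have hpU : ∀ w, IsPMF (pU w) := fun w => by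
    refine ⟨hpU0 w, ?_⟩
    simp only [pU, ← ha]
    simp
  have hT : ∀ u x y z, Q x y z * pU (x, y, z) u =
      a u x * ∑ x', Q x' y z * pU (x', y, z) u := fun u x y z => by
    simp only [pU]
    split_ifs with hu
    · simp only [← hu, mul_one, alphaVec_mul_column_sum hQ0]
    · simp
  have hWa : ∀ u x y, W u x = a u x * ∑ x', W u x' := fun u x y => by
    simp only [← hW u _ y]
    rw [Finset.sum_comm, Finset.mul_sum]
    exact Finset.sum_congr rfl fun z _ => hT u x y z
  refine ⟨S.card, pU, (secureAux_iff_factorization hQ hfs).2 ⟨hpU, W,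
    fun u y z => (∑ x, Q x y z * pU (x, y, z) u) / ∑ x, W u x,
    fun u y z => if alphaVec Q y z = a u then 1 else 0, hW,
    fun u x y z => ?_, fun u x y z => mul_comm _ _⟩⟩
  by_cases h0 : ∑ x, W u x = 0
  · have hWux : W u x = 0 := by rw [hWa u x y, h0, mul_zero]
    rw [hWux, mul_zero]
    exact (Finset.sum_eq_zero_iff_of_nonneg
      fun z _ => mul_nonneg (hQ0 x y z) (hpU0 (x, y, z) u)).1 ((hW u x y).trans hWux) z
      (Finset.mem_univ z)
  · rw [hT, hWa u x y, mul_left_comm, div_mul_cancel₀ _ h0]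

end SecureComputation

variable {𝒳 𝒴 𝒵 : Type*} [Fintype 𝒳] [Fintype 𝒴] [Fintype 𝒵]
variable [Nonempty 𝒳] [Nonempty 𝒴] [Nonempty 𝒵]

/-- **Theorem 3.** Suppose `p_XY` has full support. Then
`(p_XY, p_{Z|XY})` is computable with perfect security iff (1) for all `y, y'` the
numbers of classes and the sets of class probability vectors coincide, and (2) classes
matched across `y, y'` by having equal probability vectors have equal column sums
`Σ_{z ∈ Z_i^(y)} p_{Z|XY}(z|x,y)` for every `x`. -/
theorem perfect_security_characterization
    (pXY : 𝒳 × 𝒴 → ℝ) (Q : 𝒳 → 𝒴 → 𝒵 → ℝ)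
    (hpXY : IsPMF pXY) (hQ : ∀ x y, IsPMF (Q x y))
    (hfs : ∀ x y, 0 < pXY (x, y)) :
    PerfectlySecure pXY Q ↔
      ((∀ y y' : 𝒴, (alphaSet Q y).ncard = (alphaSet Q y').ncard ∧
          alphaSet Q y = alphaSet Q y') ∧
       (∀ (y y' : 𝒴) (z₀ z₀' : 𝒵), z₀ ∈ Zyset Q y → z₀' ∈ Zyset Q y' →
          alphaVec Q y z₀ = alphaVec Q y' z₀' →
          ∀ x, classSumOf Q x y z₀ = classSumOf Q x y' z₀')) := by
  rw [class_conditions_iff_classSumA_eq fun x y => (hQ x y).1]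
  exact ⟨fun h => h.classSumA_eq hQ hfs, perfectlySecure_of_classSumA_eq hQ hfs⟩


end SC
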